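/- Let s_n denote the number of simple permutations of length n in 𝒜. Then s_4 = 2 and for all n ≥ 4, s_{n+1} = 3·s_n + 2·(−1)^{n+1}. -/

import Mathlib

/-- `σ` is contained in `π` as a pattern. -/
def Contains {k n : ℕ} (σ : Equiv.Perm (Fin k)) (π : Equiv.Perm (Fin n)) : Prop :=
  ∃ f : Fin k → Fin n, StrictMono f ∧ ∀ i j : Fin k, σ i < σ j ↔ π (f i) < π (f j)

/-- `π` avoids the pattern `σ`. -/
def Avoids {k n : ℕ} (σ : Equiv.Perm (Fin k)) (π : Equiv.Perm (Fin n)) : Prop :=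
  ¬ Contains σ π

/-- The permutation 4231 (0-indexed values). -/
noncomputable def p4231 : Equiv.Perm (Fin 4) := Equiv.ofBijective ![3,1,2,0] (by decide)

/-- The permutation 35142 (0-indexed values). -/
noncomputable def p35142 : Equiv.Perm (Fin 5) := Equiv.ofBijective ![2,4,0,3,1] (by decide)

/-- The permutation 42513 (0-indexed values). -/
noncomputable def p42513 : Equiv.Perm (Fin 5) := Equiv.ofBijective ![3,1,4,0,2] (by decide)

/-- The permutation 351624 (0-indexed values). -/
noncomputable def p351624 : Equiv.Perm (Fin 6) := Equiv.ofBijective ![2,4,0,5,1,3] (by decide)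

/-- Membership in the class 𝒜 = Av(4231, 35142, 42513, 351624). -/
def InA {n : ℕ} (π : Equiv.Perm (Fin n)) : Prop :=
  Avoids p4231 π ∧ Avoids p35142 π ∧ Avoids p42513 π ∧ Avoids p351624 π

/-- `s` is an interval of `π`: a set of consecutive positions whose image
under `π` is a set of consecutive values. -/
def IsPermInterval {n : ℕ} (π : Equiv.Perm (Fin n)) (s : Finset (Fin n)) : Prop :=
  (∀ a ∈ s, ∀ b ∈ s, ∀ j : Fin n, a ≤ j → j ≤ b → j ∈ s) ∧
  (∀ a ∈ s, ∀ b ∈ s, ∀ j : Fin n, π a ≤ π j → π j ≤ π b → j ∈ s)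

/-- `π` is simple: its only intervals are singletons (or empty) and the whole domain. -/
def IsSimple {n : ℕ} (π : Equiv.Perm (Fin n)) : Prop :=
  ∀ s : Finset (Fin n), IsPermInterval π s → s.card ≤ 1 ∨ s = Finset.univ

/-- The reverse complement of a permutation. -/
def revComp {n : ℕ} (π : Equiv.Perm (Fin n)) : Equiv.Perm (Fin n) :=
  (Fin.revPerm.trans π).trans Fin.revPerm

/-- The skew sum `σ ⊖ τ`. -/
def skewSum {m k : ℕ} (σ : Equiv.Perm (Fin m)) (τ : Equiv.Perm (Fin k)) :
    Equiv.Perm (Fin (m + k)) :=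
  finSumFinEquiv.symm.trans ((Equiv.sumCongr σ τ).trans
    ((Equiv.sumComm (Fin m) (Fin k)).trans (finSumFinEquiv.trans (finCongr (Nat.add_comm k m)))))

/-- The direct sum `α ⊕ β`. -/
def directSum {m k : ℕ} (α : Equiv.Perm (Fin m)) (β : Equiv.Perm (Fin k)) :
    Equiv.Perm (Fin (m + k)) :=
  finSumFinEquiv.symm.trans ((Equiv.sumCongr α β).trans finSumFinEquiv)

/-- The permutation 312 (0-indexed values). -/
noncomputable def p312 : Equiv.Perm (Fin 3) := Equiv.ofBijective ![2,0,1] (by decide)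

/-- The permutation 231 (0-indexed values). -/
noncomputable def p231 : Equiv.Perm (Fin 3) := Equiv.ofBijective ![1,2,0] (by decide)

/-- The number of simple permutations of length `n` in the class 𝒜. -/
noncomputable def simpleCount (n : ℕ) : ℕ :=
  Nat.card {π : Equiv.Perm (Fin n) // IsSimple π ∧ InA π}

open Equiv

theorem contains_inv {k n : ℕ} {p : Perm (Fin k)} {σ : Perm (Fin n)} (h : Contains p σ) :
    Contains p.symm σ.symm := by
  obtain ⟨f, hf, hp⟩ := h
  refine ⟨fun x => σ (f (p.symm x)), ?_, ?_⟩
  · intro x y hxy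
    exact (hp _ _).1 (by simpa using hxy)
  · intro x y
    simp [hf.lt_iff_lt]

theorem p4231_symm : p4231.symm = p4231 :=
  Equiv.ext fun i => (Equiv.symm_apply_eq _).2 (by revert i; decide)

theorem p35142_symm : p35142.symm = p35142 :=
  Equiv.ext fun i => (Equiv.symm_apply_eq _).2 (by revert i; decide)

theorem p42513_symm : p42513.symm = p42513 :=
  Equiv.ext fun i => (Equiv.symm_apply_eq _).2 (by revert i; decide)

theorem p351624_symm : p351624.symm = p351624 :=
  Equiv.ext fun i => (Equiv.symm_apply_eq _).2 (by revert i; decide)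

theorem InA.symm {n : ℕ} {σ : Perm (Fin n)} (h : InA σ) : InA σ.symm := by
  obtain ⟨h1, h2, h3, h4⟩ := h
  refine ⟨fun h => h1 ?_, fun h => h2 ?_, fun h => h3 ?_, fun h => h4 ?_⟩
  · simpa [p4231_symm] using contains_inv h
  · simpa [p35142_symm] using contains_inv h
  · simpa [p42513_symm] using contains_inv h
  · simpa [p351624_symm] using contains_inv h

theorem IsSimple.symm {n : ℕ} {σ : Perm (Fin n)} (h : IsSimple σ) : IsSimple σ.symm := by
  intro s hs
  have := h (s.map σ.symm.toEmbedding) ⟨?_, ?_⟩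
  · rwa [Finset.card_map, ← Finset.map_univ_equiv σ.symm, Finset.map_inj] at this
  · intro a ha b hb j haj hjb
    simp only [Finset.mem_map_equiv, Equiv.symm_symm] at *
    exact hs.2 _ ha _ hb _ (by simpa using haj) (by simpa using hjb)
  · intro a ha b hb j haj hjb
    simp only [Finset.mem_map_equiv, Equiv.symm_symm] at *
    exact hs.1 _ ha _ hb _ (by simpa using haj) (by simpa using hjb)

theorem InA.not_4231 {n : ℕ} {σ : Perm (Fin n)} (h : InA σ) {i j k l : Fin n}
    (hij : i < j) (hjk : j < k) (hkl : k < l)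
    (h1 : σ l < σ j) (h2 : σ j < σ k) (h3 : σ k < σ i) : False := by
  refine h.1 ⟨![i, j, k, l], ?_, ?_⟩
  · rw [Fin.strictMono_iff_lt_succ]
    intro x
    fin_cases x <;> assumption
  · intro x y
    have : p4231 x = ![3,1,2,0] x := rfl
    have : p4231 y = ![3,1,2,0] y := rfl
    fin_cases x <;> fin_cases y <;> simp_all <;> order

theorem InA.not_35142 {n : ℕ} {σ : Perm (Fin n)} (h : InA σ) {i j k l m : Fin n}
    (hij : i < j) (hjk : j < k) (hkl : k < l) (hlm : l < m)
    (h1 : σ k < σ m) (h2 : σ m < σ i) (h3 : σ i < σ l) (h4 : σ l < σ j) : False := by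
  refine h.2.1 ⟨![i, j, k, l, m], ?_, ?_⟩
  · rw [Fin.strictMono_iff_lt_succ]
    intro x
    fin_cases x <;> assumption
  · intro x y
    have : p35142 x = ![2,4,0,3,1] x := rfl
    have : p35142 y = ![2,4,0,3,1] y := rfl
    fin_cases x <;> fin_cases y <;> simp_all <;> order

theorem InA.not_42513 {n : ℕ} {σ : Perm (Fin n)} (h : InA σ) {i j k l m : Fin n}
    (hij : i < j) (hjk : j < k) (hkl : k < l) (hlm : l < m)
    (h1 : σ l < σ j) (h2 : σ j < σ m) (h3 : σ m < σ i) (h4 : σ i < σ k) : False := by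
  refine h.2.2.1 ⟨![i, j, k, l, m], ?_, ?_⟩
  · rw [Fin.strictMono_iff_lt_succ]
    intro x
    fin_cases x <;> assumption
  · intro x y
    have : p42513 x = ![3,1,4,0,2] x := rfl
    have : p42513 y = ![3,1,4,0,2] y := rfl
    fin_cases x <;> fin_cases y <;> simp_all <;> order

theorem InA.not_351624 {n : ℕ} {σ : Perm (Fin n)} (h : InA σ) {i j k l m o : Fin n}
    (hij : i < j) (hjk : j < k) (hkl : k < l) (hlm : l < m) (hmo : m < o)
    (h1 : σ k < σ m) (h2 : σ m < σ i) (h3 : σ i < σ o) (h4 : σ o < σ j) (h5 : σ j < σ l) :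
    False := by
  refine h.2.2.2 ⟨![i, j, k, l, m, o], ?_, ?_⟩
  · rw [Fin.strictMono_iff_lt_succ]
    intro x
    fin_cases x <;> assumption
  · intro x y
    have : p351624 x = ![2,4,0,5,1,3] x := rfl
    have : p351624 y = ![2,4,0,5,1,3] y := rfl
    fin_cases x <;> fin_cases y <;> simp_all <;> order

theorem IsSimple.exists_separating {n : ℕ} {σ : Perm (Fin n)} (hS : IsSimple σ)
    (s : Finset (Fin n)) {x y z : Fin n} (hx : x ∈ s) (hy : y ∈ s) (hxy : x ≠ y) (hz : z ∉ s) :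
    ∃ a ∈ s, ∃ b ∈ s, ∃ c ∉ s, (a < c ∧ c < b) ∨ (σ a < σ c ∧ σ c < σ b) := by
  by_contra! hc
  have hI : IsPermInterval σ s := by
    refine ⟨fun a ha b hb j haj hjb => ?_, fun a ha b hb j haj hjb => ?_⟩
    · by_contra hj
      have hne : a ≠ j := by rintro rfl; exact hj ha
      have hne' : j ≠ b := by rintro rfl; exact hj hb
      exact absurd (hjb.lt_of_ne hne') (not_lt.2 ((hc a ha b hb j hj).1 (haj.lt_of_ne hne)))
    · by_contra hj
      have hne : a ≠ j := by rintro rfl; exact hj ha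
      have hne' : j ≠ b := by rintro rfl; exact hj hb
      exact absurd (hjb.lt_of_ne (σ.injective.ne hne'))
        (not_lt.2 ((hc a ha b hb j hj).2 (haj.lt_of_ne (σ.injective.ne hne))))
  rcases hS s hI with h | h
  · exact hxy (Finset.card_le_one.1 h x hx y hy)
  · simp [h] at hz

theorem Equiv.Perm.lt_of_apply_eq_zero {n : ℕ} {σ : Perm (Fin (n + 1))} {q : Fin (n + 1)}
    (hq : σ q = 0) {i : Fin (n + 1)} (hi : i ≠ q) : σ q < σ i := by
  have := σ.injective.ne hi
  rw [hq] at this ⊢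
  exact Fin.pos_of_ne_zero this

theorem corner_values {n : ℕ} {σ : Perm (Fin (n + 1))} (hA : InA σ) (hS : IsSimple σ)
    {q e f : Fin (n + 1)} (hq : σ q = 0) (heq : e < q) (he : σ e < σ 0) (hqf : q ≤ f)
    (hf : σ f < σ 0) : σ f < σ e := by
  by_contra! hef
  have hq0 : ∀ i, i ≠ q → σ q < σ i := fun i => Perm.lt_of_apply_eq_zero hq
  have he0 : 0 < e := Fin.pos_of_ne_zero (by rintro rfl; exact he.false)
  have hqe := hq0 e heq.ne
  have hfq : q < f := hqf.lt_of_ne (by rintro rfl; order)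
  have hef' : σ e < σ f := hef.lt_of_ne (σ.injective.ne (by order))
  obtain ⟨a, ha, b, hb, j, hj, hsep⟩ := hS.exists_separating
    (Finset.univ.filter fun j => σ j ≤ σ e) (x := e) (y := q) (z := 0)
    (by simp) (by simp [hq]) heq.ne (by simpa using he)
  simp only [Finset.mem_filter, Finset.mem_univ, true_and, not_le] at ha hb hj
  rcases hsep with ⟨haj, hjb⟩ | ⟨haj, hjb⟩
  · have hea : e ≤ a := by
      by_contra! hae
      have ha0 : a ≠ 0 := by rintro rfl; order
      have hae' := σ.injective.ne hae.ne
      exact hA.not_4231 (Fin.pos_of_ne_zero ha0) hae heq (hq0 a (by order)) (by order) he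
    have hej : e < j := by order
    have hj0 : j ≠ 0 := (he0.trans hej).ne'
    rcases lt_trichotomy j q with hjq | rfl | hjq
    · rcases (σ.injective.ne hj0).lt_or_gt with hj0 | hj0
      · exact hA.not_4231 he0 hej hjq hqe hj hj0
      · exact hA.not_42513 he0 hej hjq hfq hqe hef' hf hj0
    · order
    · have hbe : σ b < σ e := hb.lt_of_ne (σ.injective.ne (by order))
      rcases (σ.injective.ne hj0).lt_or_gt with hj0 | hj0
      · exact hA.not_4231 he0 hej hjb hbe hj hj0
      · rcases lt_trichotomy f b with hfb | rfl | hfb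
        · exact hA.not_4231 he0 (heq.trans hfq) hfb hbe hef' hf
        · order
        · exact hA.not_42513 he0 hej hjb hfb hbe hef' hf hj0
  · order

theorem corner_positions {n : ℕ} {σ : Perm (Fin (n + 1))} (hA : InA σ) (hS : IsSimple σ)
    {q e x : Fin (n + 1)} (hq : σ q = 0) (heq : e < q) (he : σ e < σ 0) (hxq : x < q)
    (hx : σ 0 ≤ σ x) : x < e := by
  have := corner_values hA.symm hS.symm (q := σ 0) (e := σ e) (f := σ x)
  simp only [Equiv.symm_apply_apply, (Equiv.symm_apply_eq σ).2 hq.symm] at this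
  exact this trivial he heq hx hxq

theorem IsSimple.apply_zero_ne_zero {n : ℕ} {σ : Perm (Fin (n + 3))} (hS : IsSimple σ) :
    σ 0 ≠ 0 := by
  intro h
  obtain ⟨a, ha, b, hb, j, hj, hsep⟩ := hS.exists_separating (Finset.univ.erase 0)
    (x := 1) (y := Fin.last _) (z := 0) (by simp) (by simp) (by simp [Fin.ext_iff]) (by simp)
  simp only [Finset.mem_erase, Finset.mem_univ, and_true, not_not] at ha hb hj
  subst hj
  rw [h] at hsep
  simp at hsep

theorem IsSimple.corner {n : ℕ} {σ : Perm (Fin (n + 3))} (hA : InA σ) (hS : IsSimple σ) :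
    σ 0 = 1 ∨ σ 1 = 0 := by
  obtain ⟨q, hq⟩ := σ.surjective 0
  have hq0 : ∀ i, i ≠ q → σ q < σ i := fun i => Perm.lt_of_apply_eq_zero hq
  have hq_pos : 0 < q := Fin.pos_of_ne_zero (by rintro rfl; exact hS.apply_zero_ne_zero hq)
  have h0q : σ q < σ 0 := hq0 _ hq_pos.ne
  by_contra! hne
  obtain ⟨y, hy⟩ := σ.surjective 1
  have h10 : (0 : Fin (n + 3)) < 1 := by simp
  have hle1 : ∀ i : Fin (n + 3), 0 < i → 1 ≤ i := fun i hi =>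
    Fin.one_le_of_ne_zero hi.ne'
  have hq1 : 1 < q := (hle1 q hq_pos).lt_of_ne (by rintro rfl; exact hne.2 hq)
  have ha1 : 1 < σ 0 := (hle1 _ (by order)).lt_of_ne hne.1.symm
  have hX : ∃ x, x < q ∧ σ 0 < σ x := by
    by_contra! hX
    obtain ⟨a, ha, b, hb, j, hj, hsep⟩ := hS.exists_separating
      (Finset.univ.filter fun j => j < q) (x := 0) (y := 1) (z := q)
      (by simpa using hq_pos) (by simpa using hq1) h10.ne (by simp)
    simp only [Finset.mem_filter, Finset.mem_univ, true_and, not_lt] at ha hb hj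
    have hXa := hX a ha
    have hXb := hX b hb
    rcases hsep with hsep | hsep
    · order
    · have := corner_values hA hS hq ha (by order) hj (by order)
      order
  have hB : ∃ f, q < f ∧ σ f < σ 0 := by
    by_contra! hB
    obtain ⟨a, ha, b, hb, j, hj, hsep⟩ := hS.exists_separating
      (Finset.univ.filter fun j => σ j < σ 0) (x := q) (y := y) (z := 0)
      (by simpa using h0q) (by simpa [hy] using ha1) (by rintro rfl; order) (by simp)
    simp only [Finset.mem_filter, Finset.mem_univ, true_and, not_lt] at ha hb hj
    have hBa : a ≤ q := not_lt.1 fun h => (hB a h).not_gt ha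
    have hBb : b ≤ q := not_lt.1 fun h => (hB b h).not_gt hb
    rcases hsep with hsep | hsep
    · have := corner_positions hA hS hq (by order) ha (by order) hj
      order
    · order
  obtain ⟨x, hxq, hx⟩ := hX
  obtain ⟨f, hqf, hf⟩ := hB
  obtain ⟨x₁, ⟨hx₁, hx₁'⟩, x₂, ⟨hx₂, hx₂'⟩, c, hc, hsep⟩ :
      ∃ a, (a < q ∧ σ 0 ≤ σ a) ∧ ∃ b, (b < q ∧ σ 0 ≤ σ b) ∧ ∃ c, (c < q → σ c < σ 0) ∧
        ((a < c ∧ c < b) ∨ (σ a < σ c ∧ σ c < σ b)) := by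
    simpa using hS.exists_separating
      (Finset.univ.filter fun j => j < q ∧ σ 0 ≤ σ j) (x := 0) (y := x) (z := q)
      (by simpa using hq_pos) (by simpa using ⟨hxq, hx.le⟩) (by rintro rfl; order) (by simp)
  obtain ⟨b₁, ⟨hb₁, hb₁'⟩, b₂, ⟨hb₂, hb₂'⟩, d, hd, hsep'⟩ :
      ∃ a, (q ≤ a ∧ σ a < σ 0) ∧ ∃ b, (q ≤ b ∧ σ b < σ 0) ∧ ∃ c, (q ≤ c → σ 0 ≤ σ c) ∧
        ((a < c ∧ c < b) ∨ (σ a < σ c ∧ σ c < σ b)) := by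
    simpa using hS.exists_separating
      (Finset.univ.filter fun j => q ≤ j ∧ σ j < σ 0) (x := q) (y := f) (z := 0)
      (by simpa using h0q) (by simpa using ⟨hqf.le, hf⟩) hqf.ne (by simp)
  obtain ⟨hqc, h0c, hcx⟩ : q < c ∧ σ 0 < σ c ∧ σ c < σ x₂ := by
    rcases hsep with hsep | hsep
    · have hcq : c < q := by order
      have := corner_positions hA hS hq hcq (hc hcq) hx₂ hx₂'
      order
    · have h0c : σ 0 < σ c := by order
      refine ⟨lt_of_le_of_ne ?_ (by rintro rfl; order), h0c, hsep.2⟩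
      by_contra! hcq
      have := hc hcq
      order
  obtain ⟨hqd, hdb, h0d⟩ : q < d ∧ d < b₂ ∧ σ 0 < σ d := by
    rcases hsep' with hsep' | hsep'
    · have hqd : q < d := by order
      exact ⟨hqd, hsep'.2, (hd hqd.le).lt_of_ne (σ.injective.ne (by order))⟩
    · have hdq : d < q := by
        by_contra! hqd
        have := hd hqd
        order
      have := corner_values hA hS hq hdq (by order) hb₂ hb₂'
      order
  have hx₂0 : 0 < x₂ := Fin.pos_of_ne_zero (by rintro rfl; order)
  have hqb : σ q < σ b₂ := hq0 _ (by order)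
  have hbc : b₂ < c := by
    by_contra! hcb
    exact hA.not_35142 hx₂0 hx₂ hqc (hcb.lt_of_ne (by rintro rfl; order)) hqb hb₂' h0c hcx
  have hxd : σ x₂ < σ d := by
    by_contra! hcb
    exact hA.not_35142 hx₂0 hx₂ hqd hdb hqb hb₂' h0d
      (hcb.lt_of_ne (σ.injective.ne (by order)))
  exact hA.not_351624 hx₂0 hx₂ hqd hdb hbc hqb hb₂' h0c hcx hxd

/-- The permutation obtained from `σ` by inserting a new entry of value `v` at position `i`. -/
def insertPoint {n : ℕ} (i v : Fin (n + 1)) (σ : Perm (Fin n)) : Perm (Fin (n + 1)) :=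
  (finSuccEquiv' i).trans (σ.optionCongr.trans (finSuccEquiv' v).symm)

@[simp]
theorem insertPoint_self {n : ℕ} (i v : Fin (n + 1)) (σ : Perm (Fin n)) :
    insertPoint i v σ i = v := by
  simp [insertPoint]

@[simp]
theorem insertPoint_succAbove {n : ℕ} (i v : Fin (n + 1)) (σ : Perm (Fin n)) (j : Fin n) :
    insertPoint i v σ (i.succAbove j) = v.succAbove (σ j) := by
  simp [insertPoint]

theorem insertPoint_injective {n : ℕ} (i v : Fin (n + 1)) :
    Function.Injective (insertPoint i v) := by
  intro σ τ h
  ext j : 1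
  simpa using DFunLike.congr_fun h (i.succAbove j)

theorem exists_eq_insertPoint {n : ℕ} {i v : Fin (n + 1)} {τ : Perm (Fin (n + 1))}
    (h : τ i = v) : ∃ σ, τ = insertPoint i v σ := by
  have hne : ∀ j, τ (i.succAbove j) ≠ v := fun j hj =>
    i.succAbove_ne j (τ.injective (hj.trans h.symm))
  choose g hg using fun j => Fin.exists_succAbove_eq (hne j)
  have hinj : Function.Injective g := by
    intro a b hab
    have := hg a
    rw [hab, hg b] at this
    exact (Fin.succAbove_right_injective (τ.injective this)).symm
  refine ⟨Equiv.ofBijective g (Finite.injective_iff_bijective.1 hinj), ?_⟩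
  ext j : 1
  rcases Fin.eq_self_or_eq_succAbove i j with rfl | ⟨k, rfl⟩
  · simp [h]
  · simp [hg]

theorem Contains.insertPoint {k n : ℕ} {p : Perm (Fin k)} {σ : Perm (Fin n)} (h : Contains p σ)
    (i v : Fin (n + 1)) : Contains p (insertPoint i v σ) := by
  obtain ⟨f, hf, hp⟩ := h
  refine ⟨fun x => i.succAbove (f x), (Fin.strictMono_succAbove i).comp hf, fun x y => ?_⟩
  simp [hp]

theorem contains_of_forall_ne {k n : ℕ} {p : Perm (Fin k)} {σ : Perm (Fin n)} {i v : Fin (n + 1)}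
    {f : Fin k → Fin (n + 1)} (hf : StrictMono f)
    (hp : ∀ x y, p x < p y ↔ insertPoint i v σ (f x) < insertPoint i v σ (f y))
    (hi : ∀ x, f x ≠ i) : Contains p σ := by
  choose g hg using fun x => Fin.exists_succAbove_eq (hi x)
  obtain rfl : f = fun x => i.succAbove (g x) := funext fun x => (hg x).symm
  refine ⟨g, fun x y hxy => by simpa using hf hxy, fun x y => ?_⟩
  simp [hp]

theorem InA.of_insertPoint {n : ℕ} {σ : Perm (Fin n)} {i v : Fin (n + 1)}
    (h : InA (insertPoint i v σ)) : InA σ :=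
  ⟨fun hc => h.1 (hc.insertPoint i v), fun hc => h.2.1 (hc.insertPoint i v),
    fun hc => h.2.2.1 (hc.insertPoint i v), fun hc => h.2.2.2 (hc.insertPoint i v)⟩

theorem contains_of_insertPoint_zero_one {k n : ℕ} {p : Perm (Fin (k + 1))}
    {σ : Perm (Fin (n + 1))} (hp : ∃ y z, p z < p y ∧ p y < p 0)
    (h : Contains p (insertPoint 0 1 σ)) : Contains p σ := by
  obtain ⟨f, hf, hpf⟩ := h
  refine contains_of_forall_ne hf hpf fun x hx => ?_
  have h0 : f 0 = 0 := by
    have := hf.monotone (Fin.zero_le x)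
    rwa [hx, Fin.le_zero_iff] at this
  obtain ⟨y, z, hzy, hy⟩ := hp
  rw [hpf, h0, insertPoint_self] at hy
  rw [hpf] at hzy
  rw [Fin.lt_def] at hy hzy
  rw [Fin.val_one] at hy
  omega

theorem InA.insertPoint_zero_one {n : ℕ} {σ : Perm (Fin (n + 1))} (h : InA σ) :
    InA (insertPoint 0 1 σ) :=
  ⟨fun hc => h.1 (contains_of_insertPoint_zero_one (by decide) hc),
    fun hc => h.2.1 (contains_of_insertPoint_zero_one (by decide) hc),
    fun hc => h.2.2.1 (contains_of_insertPoint_zero_one (by decide) hc),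
    fun hc => h.2.2.2 (contains_of_insertPoint_zero_one (by decide) hc)⟩

theorem contains_of_insertPoint_twin {k n : ℕ} {p : Perm (Fin (k + 1))}
    {σ : Perm (Fin (n + 1))} {q : Fin (n + 1)} {i : Fin (n + 2)} (hq : σ q = 0)
    (hi : ∀ j, j ≠ q → (j.castSucc < i ↔ j < q))
    (hp : ∀ a b, p a = 0 → a ≠ b →
      ∃ c, (a < c ∧ c < b) ∨ (b < c ∧ c < a) ∨ (p a < p c ∧ p c < p b))
    (h : Contains p (insertPoint i 0 σ)) : Contains p σ := by
  obtain ⟨f, hf, hpf⟩ := h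
  set τ := insertPoint i 0 σ with hτ
  have hτi : τ i = 0 := insertPoint_self _ _ _
  set t := i.succAbove q with ht
  have hτt : τ t = 1 := by
    rw [ht, hτ, insertPoint_succAbove, hq]
    simp
  have hti : t ≠ i := i.succAbove_ne q
  have hadj : ∀ j, j ≠ i → j ≠ t → (j < i ↔ j < t) := by
    intro j hji hjt
    obtain ⟨j, rfl⟩ := Fin.exists_succAbove_eq hji
    have hjq : j ≠ q := by rintro rfl; exact hjt rfl
    rw [Fin.succAbove_lt_iff_castSucc_lt, hi j hjq, ht, Fin.succAbove_lt_succAbove_iff]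
  have hval : ∀ j, j ≠ i → j ≠ t → τ t < τ j := by
    intro j hji hjt
    have h1 := τ.injective.ne hji
    have h2 := τ.injective.ne hjt
    rw [hτi] at h1
    rw [hτt] at h2 ⊢
    exact (Fin.one_le_of_ne_zero h1).lt_of_ne h2.symm
  by_cases hx : ∃ x, f x = i
  · obtain ⟨x, hx⟩ := hx
    have hy : ∀ y, f y ≠ t := by
      intro y hy
      have hpx : p x = 0 := by
        by_contra hne
        have : p (p.symm 0) < p x := by simpa using Fin.pos_of_ne_zero hne
        rw [hpf, hx, hτi] at this
        exact Fin.not_lt_zero _ this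
      have hxy : x ≠ y := by rintro rfl; exact hti (hy.symm.trans hx)
      obtain ⟨c, hc⟩ := hp x y hpx hxy
      have hcx : c ≠ x := by
        rintro rfl
        simp at hc
      have hcy : c ≠ y := by
        rintro rfl
        simp at hc
      have hcx' : f c ≠ i := fun h => hcx (hf.injective (h.trans hx.symm))
      have hcy' : f c ≠ t := fun h => hcy (hf.injective (h.trans hy.symm))
      have := hadj _ hcx' hcy'
      have := hval _ hcx' hcy'
      rw [hpf, hpf, ← hf.lt_iff_lt, ← hf.lt_iff_lt, ← hf.lt_iff_lt (a := y),
        ← hf.lt_iff_lt (a := c), hx, hy] at hc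
      grind
    have hfx : ∀ y, y ≠ x → f y ≠ i := fun y hyx h => hyx (hf.injective (h.trans hx.symm))
    refine contains_of_forall_ne (i := i) (v := 0) (f := Function.update f x t) ?_ ?_ ?_
    · intro y z hyz
      have := hf hyz
      rcases eq_or_ne y x with rfl | hyx
      · have h1 := hadj _ (hfx z hyz.ne') (hy z)
        simp only [Function.update_self, Function.update_of_ne hyz.ne']
        refine (hy z).lt_or_gt.resolve_left fun h => ?_
        have := h1.2 h
        order
      · rcases eq_or_ne z x with rfl | hzx
        · have h1 := hadj _ (hfx y hyz.ne) (hy y)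
          simp only [Function.update_self, Function.update_of_ne hyz.ne]
          exact h1.1 (hx ▸ this)
        · simpa only [Function.update_of_ne hyx, Function.update_of_ne hzx]
    · intro y z
      rw [← hτ, hpf]
      have h0 : ∀ y, y ≠ x → τ i < τ (f y) := fun y hyx => by
        rw [hτi]
        exact Fin.pos_of_ne_zero fun h => hfx y hyx (τ.injective (h.trans hτi.symm))
      rcases eq_or_ne y x with rfl | hyx
      · rcases eq_or_ne z y with rfl | hzy
        · simp
        · simp only [Function.update_self, Function.update_of_ne hzy, hx, h0 z hzy,
            hval _ (hfx z hzy) (hy z)]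
      · rcases eq_or_ne z x with rfl | hzx
        · simp only [Function.update_self, Function.update_of_ne hyx, hx, (h0 y hyx).not_gt,
            (hval _ (hfx y hyx) (hy y)).not_gt]
        · simp only [Function.update_of_ne hyx, Function.update_of_ne hzx]
    · intro y
      rcases eq_or_ne y x with rfl | hyx
      · simpa using hti
      · simpa [hyx] using hfx y hyx
  · exact contains_of_forall_ne hf hpf (not_exists.1 hx)

theorem InA.insertPoint_twin {n : ℕ} {σ : Perm (Fin (n + 1))} {q : Fin (n + 1)}
    {i : Fin (n + 2)} (h : InA σ) (hq : σ q = 0) (hi : ∀ j, j ≠ q → (j.castSucc < i ↔ j < q)) :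
    InA (insertPoint i 0 σ) :=
  ⟨fun hc => h.1 (contains_of_insertPoint_twin hq hi (by decide) hc),
    fun hc => h.2.1 (contains_of_insertPoint_twin hq hi (by decide) hc),
    fun hc => h.2.2.1 (contains_of_insertPoint_twin hq hi (by decide) hc),
    fun hc => h.2.2.2 (contains_of_insertPoint_twin hq hi (by decide) hc)⟩

theorem IsPermInterval.preimage {n : ℕ} {σ : Perm (Fin n)} {i v : Fin (n + 1)}
    {s : Finset (Fin (n + 1))} (h : IsPermInterval (insertPoint i v σ) s) :
    IsPermInterval σ (Finset.univ.filter fun j => i.succAbove j ∈ s) := by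
  constructor
  · intro a ha b hb j haj hjb
    simp only [Finset.mem_filter, Finset.mem_univ, true_and] at *
    exact h.1 _ ha _ hb _ (by simpa using haj) (by simpa using hjb)
  · intro a ha b hb j haj hjb
    simp only [Finset.mem_filter, Finset.mem_univ, true_and] at *
    exact h.2 _ ha _ hb _ (by simpa using haj) (by simpa using hjb)

theorem IsPermInterval.map_succAbove {n : ℕ} {σ : Perm (Fin n)} {i v : Fin (n + 1)}
    {s : Finset (Fin n)} (h : IsPermInterval σ s)
    (hi : ∀ a ∈ s, ∀ b ∈ s, a.castSucc < i → i ≤ b.castSucc → False)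
    (hv : ∀ a ∈ s, ∀ b ∈ s, (σ a).castSucc < v → v ≤ (σ b).castSucc → False) :
    IsPermInterval (insertPoint i v σ) (s.map i.succAboveEmb) := by
  constructor
  · intro a ha b hb j haj hjb
    simp only [Finset.mem_map, Fin.coe_succAboveEmb] at ha hb ⊢
    obtain ⟨a, ha, rfl⟩ := ha
    obtain ⟨b, hb, rfl⟩ := hb
    rcases Fin.eq_self_or_eq_succAbove i j with rfl | ⟨j, rfl⟩
    · refine (hi a ha b hb ?_ ?_).elim
      · exact Fin.succAbove_lt_iff_castSucc_lt _ _ |>.1 (haj.lt_of_ne (Fin.succAbove_ne _ _))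
      · exact Fin.lt_succAbove_iff_le_castSucc _ _ |>.1 (hjb.lt_of_ne (Fin.succAbove_ne _ _).symm)
    · exact ⟨j, h.1 _ ha _ hb _ (by simpa using haj) (by simpa using hjb), rfl⟩
  · intro a ha b hb j haj hjb
    simp only [Finset.mem_map, Fin.coe_succAboveEmb] at ha hb ⊢
    obtain ⟨a, ha, rfl⟩ := ha
    obtain ⟨b, hb, rfl⟩ := hb
    rcases Fin.eq_self_or_eq_succAbove i j with rfl | ⟨j, rfl⟩
    · rw [insertPoint_self, insertPoint_succAbove] at haj hjb
      refine (hv a ha b hb ?_ ?_).elim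
      · exact Fin.succAbove_lt_iff_castSucc_lt _ _ |>.1 (haj.lt_of_ne (Fin.succAbove_ne _ _))
      · exact Fin.lt_succAbove_iff_le_castSucc _ _ |>.1 (hjb.lt_of_ne (Fin.succAbove_ne _ _).symm)
    · exact ⟨j, h.2 _ ha _ hb _ (by simpa using haj) (by simpa using hjb), rfl⟩

/-- `σ` lies in the class, does not end with its maximum, and each of its nontrivial intervals
contains its minimum. -/
def AlmostSimple {n : ℕ} (σ : Perm (Fin (n + 1))) : Prop :=
  InA σ ∧ σ (Fin.last n) ≠ Fin.last n ∧
    ∀ q, σ q = 0 → ∀ s, IsPermInterval σ s → q ∉ s → s.card ≤ 1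

/-- The minimum of `σ` forms an interval with an adjacent entry, which lies on its left if `d` is
true and on its right otherwise. -/
def HasTwin {n : ℕ} (d : Bool) (σ : Perm (Fin (n + 1))) : Prop :=
  ∃ q j, σ q = 0 ∧ j ≠ q ∧ (j < q ↔ d = true) ∧ IsPermInterval σ {q, j}

theorem isPermInterval_compl_of_zero_mem {n : ℕ} {σ : Perm (Fin (n + 1))} {q : Fin (n + 1)}
    (hq : σ q = 0) {s : Finset (Fin (n + 1))} (h : IsPermInterval σ s) (h0 : 0 ∈ s)
    (hqs : q ∈ s) : IsPermInterval σ sᶜ := by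
  constructor
  · intro a ha b _ j haj _
    rw [Finset.mem_compl] at *
    exact fun hj => ha (h.1 0 h0 j hj a (Fin.zero_le _) haj)
  · intro a ha b _ j haj _
    rw [Finset.mem_compl] at *
    exact fun hj => ha (h.2 q hqs j hj a (hq ▸ Fin.zero_le _) haj)

theorem AlmostSimple.eq_univ {n : ℕ} {σ : Perm (Fin (n + 1))} (hσ : AlmostSimple σ)
    {q : Fin (n + 1)} (hq : σ q = 0) {s : Finset (Fin (n + 1))} (h : IsPermInterval σ s)
    (h0 : 0 ∈ s) (hqs : q ∈ s) : s = Finset.univ := by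
  have hc := Finset.card_le_one.1
    (hσ.2.2 q hq _ (isPermInterval_compl_of_zero_mem hq h h0 hqs) (by simpa using hqs))
  by_contra hne
  obtain ⟨z, hz⟩ : ∃ z, z ∉ s := by
    simpa [Finset.eq_univ_iff_forall] using hne
  have hl : Fin.last n ∉ s := fun hl => hz (h.1 0 h0 _ hl z (Fin.zero_le _) (Fin.le_last _))
  have hm : σ.symm (Fin.last n) ∉ s := fun hl =>
    hz (h.2 q hqs _ hl z (hq ▸ Fin.zero_le _) (by simpa using Fin.le_last _))
  have := hc _ (Finset.mem_compl.2 hl) _ (Finset.mem_compl.2 hm)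
  exact hσ.2.1 (by rw [this, Equiv.apply_symm_apply, ← this])

theorem IsSimple.apply_last_ne_last {n : ℕ} {σ : Perm (Fin (n + 3))} (hS : IsSimple σ) :
    σ (Fin.last _) ≠ Fin.last _ := by
  intro h
  obtain ⟨a, ha, b, hb, j, hj, hsep⟩ := hS.exists_separating (Finset.univ.erase (Fin.last _))
    (x := 0) (y := 1) (z := Fin.last _) (by simp [Fin.ext_iff])
    (by simp [Fin.ext_iff]) (by simp) (by simp)
  simp only [Finset.mem_erase, Finset.mem_univ, and_true, not_not] at ha hb hj
  subst hj
  rw [h] at hsep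
  rcases hsep with hsep | hsep
  · exact absurd hsep.2 (Fin.le_last _).not_gt
  · exact absurd hsep.2 (Fin.le_last _).not_gt

theorem IsSimple.almostSimple {n : ℕ} {σ : Perm (Fin (n + 3))} (hS : IsSimple σ) (hA : InA σ) :
    AlmostSimple σ :=
  ⟨hA, hS.apply_last_ne_last, fun _ _ s hs hqs =>
    (hS s hs).resolve_right fun h => hqs (h ▸ Finset.mem_univ _)⟩

theorem AlmostSimple.isSimple {n : ℕ} {σ : Perm (Fin (n + 3))} (hσ : AlmostSimple σ)
    (h : σ 0 = 1) : IsSimple σ := by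
  intro s hs
  obtain ⟨q, hq⟩ := σ.surjective 0
  by_cases hqs : q ∈ s
  · by_cases hj : ∃ j ∈ s, j ≠ q
    · obtain ⟨j, hj, hjq⟩ := hj
      refine Or.inr (hσ.eq_univ hq hs (hs.2 q hqs j hj 0 ?_ ?_) hqs)
      · rw [hq]
        exact Fin.zero_le _
      · rw [h]
        exact Fin.one_le_of_ne_zero fun h' => hjq (σ.injective (h'.trans hq.symm))
    · push Not at hj
      exact Or.inl (Finset.card_le_one.2 fun a ha b hb => (hj a ha).trans (hj b hb).symm)
  · exact Or.inl (hσ.2.2 q hq s hs hqs)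

theorem AlmostSimple.apply_zero_ne_zero {n : ℕ} {σ : Perm (Fin (n + 3))} (hσ : AlmostSimple σ) :
    σ 0 ≠ 0 := by
  intro h
  have := hσ.2.2 0 h ({0}ᶜ)
    (isPermInterval_compl_of_zero_mem h ⟨by simp +contextual, ?_⟩ (by simp) (by simp)) (by simp)
  · simp [Finset.card_compl] at this
  · intro a ha b hb j haj hjb
    simp only [Finset.mem_singleton] at *
    subst ha hb
    exact σ.injective (le_antisymm hjb haj)

theorem insertPoint_zero_one_succ {n : ℕ} (σ : Perm (Fin (n + 1))) (j : Fin (n + 1)) :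
    insertPoint 0 1 σ j.succ = Fin.succAbove 1 (σ j) := by
  rw [← insertPoint_succAbove 0 1, Fin.succAbove_zero]

theorem AlmostSimple.isSimple_insertPoint {n : ℕ} {σ : Perm (Fin (n + 3))}
    (hσ : AlmostSimple σ) (h1 : σ 0 ≠ 1) : IsSimple (insertPoint 0 1 σ) := by
  intro s hs
  obtain ⟨q, hq⟩ := σ.surjective 0
  have hs' := hs.preimage
  set s' := Finset.univ.filter fun j => Fin.succAbove 0 j ∈ s with hs'_def
  have hmem : ∀ j, j ∈ s' ↔ j.succ ∈ s := fun j => by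
    rw [hs'_def, Finset.mem_filter]
    simp
  have hτ0 : insertPoint 0 1 σ 0 = 1 := insertPoint_self _ _ _
  have hτ := insertPoint_zero_one_succ σ
  by_cases h0 : 0 ∈ s
  · have h0' : ∀ j ∈ s', 0 ∈ s' := fun j hj => by
      rw [hmem] at *
      exact hs.1 0 h0 _ hj _ (Fin.zero_le _) (Fin.succ_le_succ_iff.2 (Fin.zero_le _))
    by_cases hqs : q ∈ s'
    · have := hσ.eq_univ hq hs' (h0' q hqs) hqs
      right
      refine Finset.eq_univ_of_forall fun j => ?_
      rcases Fin.eq_zero_or_eq_succ j with rfl | ⟨j, rfl⟩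
      · exact h0
      · rw [← hmem, this]
        exact Finset.mem_univ _
    · have hc := Finset.card_le_one.1 (hσ.2.2 q hq s' hs' hqs)
      left
      have hempty : ∀ j, j ∉ s' := by
        intro j hj
        obtain ⟨k, hk⟩ := σ.surjective 1
        have hks : k ∈ s' := by
          have h0s := h0' j hj
          rw [hmem] at h0s ⊢
          have hne := hσ.apply_zero_ne_zero
          refine hs.2 0 h0 _ h0s _ ?_ ?_
          · rw [hτ0, hτ, hk]
            exact ((Fin.lt_succAbove_iff_le_castSucc _ _).2 (Fin.castSucc_one ▸ le_rfl)).le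
          · rw [hτ, hτ, hk, Fin.succAbove_le_succAbove_iff]
            exact Fin.one_le_of_ne_zero hne
        have := hc _ hks _ (h0' j hj)
        exact h1 (this ▸ hk)
      have : ∀ j ∈ s, j = 0 := by
        intro j hj
        rcases Fin.eq_zero_or_eq_succ j with rfl | ⟨j, rfl⟩
        · rfl
        · exact (hempty j ((hmem j).2 hj)).elim
      exact Finset.card_le_one.2 fun a ha b hb => (this a ha).trans (this b hb).symm
  · left
    have hcard : ∀ a ∈ s', ∀ b ∈ s', a = b := by
      by_cases hqs : q ∈ s'
      · have : ∀ j ∈ s', j = q := by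
          intro j hj
          by_contra hjq
          rw [hmem] at hj hqs
          refine h0 (hs.2 _ hqs _ hj _ ?_ ?_)
          · rw [hτ0, hτ, hq]
            simp
          · rw [hτ0, hτ]
            have h0 : 0 < σ j := hq ▸ Perm.lt_of_apply_eq_zero hq hjq
            refine ((Fin.lt_succAbove_iff_le_castSucc _ _).2 ?_).le
            rw [← Fin.castSucc_one, Fin.castSucc_le_castSucc_iff]
            exact Fin.one_le_of_ne_zero h0.ne'
        exact fun a ha b hb => (this a ha).trans (this b hb).symm
      · exact Finset.card_le_one.1 (hσ.2.2 q hq s' hs' hqs)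
    refine Finset.card_le_one.2 fun a ha b hb => ?_
    rcases Fin.eq_zero_or_eq_succ a with rfl | ⟨a, rfl⟩
    · exact (h0 ha).elim
    rcases Fin.eq_zero_or_eq_succ b with rfl | ⟨b, rfl⟩
    · exact (h0 hb).elim
    rw [hcard a ((hmem a).2 ha) b ((hmem b).2 hb)]

theorem IsSimple.almostSimple_of_insertPoint {n : ℕ} {σ : Perm (Fin (n + 3))}
    (hS : IsSimple (insertPoint 0 1 σ)) (hA : InA (insertPoint 0 1 σ)) :
    AlmostSimple σ ∧ σ 0 ≠ 1 := by
  have hτ0 : insertPoint 0 1 σ 0 = 1 := insertPoint_self _ _ _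
  have hτ := insertPoint_zero_one_succ σ
  refine ⟨⟨hA.of_insertPoint, fun h => ?_, fun q hq s hs hqs => ?_⟩, fun h => ?_⟩
  · refine hS.apply_last_ne_last ?_
    rw [← Fin.succ_last, hτ, h, Fin.succAbove_of_le_castSucc]
    simp [Fin.le_def]
  · have := hS _ (hs.map_succAbove (i := 0) (v := 1) ?_ ?_)
    · rw [Finset.card_map] at this
      refine this.resolve_right fun h => ?_
      have := h ▸ Finset.mem_univ (0 : Fin (n + 4))
      simp at this
    · intro a _ _ _ h
      exact absurd h (Fin.not_lt_zero _)
    · intro a ha b hb h _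
      refine hqs ((σ.injective ?_ : a = q) ▸ ha)
      rw [hq]
      rw [Fin.lt_def] at h
      rw [Fin.ext_iff]
      simpa using h
  · obtain ⟨a, ha, b, hb, j, hj, hsep⟩ := hS.exists_separating {0, 1}
      (x := 0) (y := 1) (z := Fin.last _) (by simp) (by simp) (by simp) (by simp [Fin.ext_iff])
    have h1 : insertPoint 0 1 σ 1 = 2 := by
      refine (hτ 0).trans ?_
      rw [h, Fin.succAbove_of_le_castSucc]
      · rfl
      · simp
    simp only [Finset.mem_insert, Finset.mem_singleton] at ha hb hj
    have v1 : ((1 : Fin (n + 4)) : ℕ) = 1 := rfl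
    have v2 : ((2 : Fin (n + 4)) : ℕ) = 2 := rfl
    have v0 : ((0 : Fin (n + 4)) : ℕ) = 0 := rfl
    simp only [Fin.lt_def] at hsep
    rcases ha with rfl | rfl <;> rcases hb with rfl | rfl <;> simp only [hτ0, h1] at hsep <;> omega

theorem insertPoint_zero_succAbove {n : ℕ} (i : Fin (n + 2)) (σ : Perm (Fin (n + 1)))
    (j : Fin (n + 1)) : insertPoint i 0 σ (i.succAbove j) = (σ j).succ := by
  simp

theorem eq_of_insertPoint_eq_zero {n : ℕ} {i j : Fin (n + 2)} {σ : Perm (Fin (n + 1))}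
    (h : insertPoint i 0 σ j = 0) : j = i :=
  (insertPoint i 0 σ).injective (by simp [h])

theorem insertPoint_last_eq_last_iff {n : ℕ} {σ : Perm (Fin (n + 2))} {q : Fin (n + 2)}
    {i : Fin (n + 3)} (hq : σ q = 0) (hi : ∀ j, j ≠ q → (j.castSucc < i ↔ j < q)) :
    insertPoint i 0 σ (Fin.last _) = Fin.last _ ↔ σ (Fin.last _) = Fin.last _ := by
  rcases eq_or_ne i (Fin.last _) with rfl | hne
  · have hql : Fin.last _ = q := by
      by_contra hql
      exact absurd ((hi _ hql).1 (Fin.castSucc_lt_last _)) (Fin.le_last _).not_gt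
    rw [insertPoint_self, hql, hq, ← hql]
    simp [Fin.ext_iff]
  · have := insertPoint_zero_succAbove i σ (Fin.last _)
    rw [Fin.succAbove_ne_last_last hne] at this
    rw [this, ← Fin.succ_last (n + 1), Fin.succ_inj]

theorem AlmostSimple.insertPoint_twin {n : ℕ} {d : Bool} {σ : Perm (Fin (n + 3))}
    {q : Fin (n + 3)} {i : Fin (n + 4)} (hσ : AlmostSimple σ) (hd' : ¬ HasTwin d σ)
    (hq : σ q = 0) (hi : ∀ j, j ≠ q → (j.castSucc < i ↔ j < q))
    (hd : q.castSucc < i ↔ d = true) : AlmostSimple (insertPoint i 0 σ) := by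
  refine ⟨hσ.1.insertPoint_twin hq hi,
    fun h => hσ.2.1 ((insertPoint_last_eq_last_iff hq hi).1 h), fun i' hi' s hs his => ?_⟩
  obtain rfl := eq_of_insertPoint_eq_zero hi'
  have hs' := hs.preimage
  set s' := Finset.univ.filter fun j => i'.succAbove j ∈ s with hs'_def
  have hmem : ∀ j, j ∈ s' ↔ i'.succAbove j ∈ s := fun j => by
    rw [hs'_def, Finset.mem_filter]
    simp
  by_contra hcard
  obtain ⟨a, ha, b, hb, hab⟩ := Finset.one_lt_card.1 (not_le.1 hcard)
  obtain ⟨a, rfl⟩ := Fin.exists_succAbove_eq (show a ≠ i' by rintro rfl; exact his ha)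
  obtain ⟨b, rfl⟩ := Fin.exists_succAbove_eq (show b ≠ i' by rintro rfl; exact his hb)
  rw [← hmem] at ha hb
  replace hab : a ≠ b := by rintro rfl; exact hab rfl
  have hqs : q ∈ s' := by
    by_contra hqs
    exact hab (Finset.card_le_one.1 (hσ.2.2 q hq s' hs' hqs) _ ha _ hb)
  obtain ⟨j, hj, hjq⟩ : ∃ j ∈ s', j ≠ q := by
    rcases eq_or_ne a q with rfl | haq
    · exact ⟨b, hb, hab.symm⟩
    · exact ⟨a, ha, haq⟩
  have hside : ∀ k ∈ s', k ≠ q → (k < q ↔ d = true) := by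
    intro k hk hkq
    rw [← hi k hkq, ← hd, ← Fin.succAbove_lt_iff_castSucc_lt, ← Fin.succAbove_lt_iff_castSucc_lt]
    rw [hmem] at hk hqs
    constructor
    · intro h
      by_contra! h'
      exact his (hs.1 _ hk _ hqs _ h.le h')
    · intro h
      by_contra! h'
      exact his (hs.1 _ hqs _ hk _ h.le h')
  have herase : IsPermInterval σ (s'.erase q) := by
    constructor
    · intro a ha b hb k hak hkb
      rw [Finset.mem_erase] at *
      refine ⟨?_, hs'.1 a ha.2 b hb.2 k hak hkb⟩
      rintro rfl
      have h1 := hside a ha.2 ha.1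
      have h2 := hside b hb.2 hb.1
      have h3 := h2.2 (h1.1 (hak.lt_of_ne ha.1))
      order
    · intro a ha b hb k hak hkb
      rw [Finset.mem_erase] at *
      refine ⟨?_, hs'.2 a ha.2 b hb.2 k hak hkb⟩
      rintro rfl
      exact absurd hak (Perm.lt_of_apply_eq_zero hq ha.1).not_ge
  have hle := Finset.card_le_one.1 (hσ.2.2 q hq _ herase (Finset.notMem_erase _ _))
  have hpair : s' = {q, j} := by
    ext k
    rw [Finset.mem_insert, Finset.mem_singleton]
    constructor
    · intro hk
      by_cases hkq : k = q
      · exact Or.inl hkq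
      · exact Or.inr (hle _ (Finset.mem_erase.2 ⟨hkq, hk⟩) _ (Finset.mem_erase.2 ⟨hjq, hj⟩))
    · rintro (rfl | rfl) <;> assumption
  exact hd' ⟨q, j, hq, hjq, hside j hj hjq, hpair ▸ hs'⟩

theorem AlmostSimple.of_insertPoint_twin {n : ℕ} {d : Bool} {σ : Perm (Fin (n + 3))}
    {q : Fin (n + 3)} {i : Fin (n + 4)} (hτ : AlmostSimple (insertPoint i 0 σ))
    (hq : σ q = 0) (hi : ∀ j, j ≠ q → (j.castSucc < i ↔ j < q))
    (hd : q.castSucc < i ↔ d = true) : AlmostSimple σ ∧ ¬ HasTwin d σ := by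
  have key : ∀ s, IsPermInterval σ s →
      (∀ a ∈ s, ∀ b ∈ s, a.castSucc < i → i ≤ b.castSucc → False) → s.card ≤ 1 := by
    intro s hs hsep
    have := hτ.2.2 i (insertPoint_self _ _ _) _
      (hs.map_succAbove hsep fun _ _ _ _ h _ => absurd h (Fin.not_lt_zero _)) (by simp)
    rwa [Finset.card_map] at this
  refine ⟨⟨hτ.1.of_insertPoint, fun h => hτ.2.1 ((insertPoint_last_eq_last_iff hq hi).2 h), ?_⟩, ?_⟩
  · intro q' hq' s hs hqs
    obtain rfl : q' = q := σ.injective (hq'.trans hq.symm)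
    refine key s hs fun a ha b hb hai hib => ?_
    have haq : a ≠ q' := by rintro rfl; exact hqs ha
    have hbq : b ≠ q' := by rintro rfl; exact hqs hb
    refine hqs (hs.1 a ha b hb q' ((hi a haq).1 hai).le ?_)
    exact not_lt.1 fun h => ((hi b hbq).2 h).not_ge hib
  · rintro ⟨q', j, hq', hjq, hjd, hs⟩
    obtain rfl : q' = q := σ.injective (hq'.trans hq.symm)
    have := key _ hs fun a ha b hb hai hib => ?_
    · rw [Finset.card_pair hjq.symm] at this
      omega
    · have hall : ∀ c ∈ ({q', j} : Finset (Fin (n + 3))), (c.castSucc < i ↔ d = true) := by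
        intro c hc
        rw [Finset.mem_insert, Finset.mem_singleton] at hc
        rcases hc with rfl | rfl
        · exact hd
        · rw [hi _ hjq, hjd]
      exact ((hall b hb).2 ((hall a ha).1 hai)).not_ge hib

theorem hasTwin_insertPoint {n : ℕ} {d : Bool} {σ : Perm (Fin (n + 1))} {q : Fin (n + 1)}
    {i : Fin (n + 2)} (hq : σ q = 0) (hi : ∀ j, j ≠ q → (j.castSucc < i ↔ j < q))
    (hd : q.castSucc < i ↔ d = true) : HasTwin d (insertPoint i 0 σ) := by
  refine ⟨i, i.succAbove q, insertPoint_self _ _ _, Fin.succAbove_ne _ _, ?_, ?_, ?_⟩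
  · rw [Fin.succAbove_lt_iff_castSucc_lt, hd]
  · intro a ha b hb k hak hkb
    rcases Fin.eq_self_or_eq_succAbove i k with rfl | ⟨k, rfl⟩
    · simp
    rcases eq_or_ne k q with rfl | hkq
    · simp
    have h1 := hi k hkq
    rw [← Fin.succAbove_lt_iff_castSucc_lt] at h1
    have h2 : i.succAbove k < i.succAbove q ↔ k < q := Fin.succAbove_lt_succAbove_iff
    have h3 := i.succAbove_ne k
    have h4 : i.succAbove k ≠ i.succAbove q := by simpa using hkq
    simp only [Finset.mem_insert, Finset.mem_singleton] at ha hb ⊢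
    grind
  · intro a ha b hb k hak hkb
    rcases Fin.eq_self_or_eq_succAbove i k with rfl | ⟨k, rfl⟩
    · simp
    rcases eq_or_ne k q with rfl | hkq
    · simp
    exfalso
    have h0 := Perm.lt_of_apply_eq_zero hq hkq
    simp only [Finset.mem_insert, Finset.mem_singleton] at hb
    rcases hb with rfl | rfl
    · rw [insertPoint_zero_succAbove, insertPoint_self] at hkb
      exact absurd hkb (Fin.succ_pos _).not_ge
    · rw [insertPoint_zero_succAbove, insertPoint_zero_succAbove, Fin.succ_le_succ_iff] at hkb
      exact hkb.not_gt h0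

/-- The position next to `q` at which a new entry is inserted. -/
def twinPos {n : ℕ} (d : Bool) (q : Fin n) : Fin (n + 1) :=
  bif d then q.succ else q.castSucc

theorem castSucc_lt_twinPos_iff {n : ℕ} (d : Bool) {q j : Fin n} (h : j ≠ q) :
    j.castSucc < twinPos d q ↔ j < q := by
  rw [ne_eq, Fin.ext_iff] at h
  cases d
  · simp [twinPos]
  · simp only [twinPos, cond_true, Fin.lt_def, Fin.val_castSucc, Fin.val_succ]
    omega

theorem castSucc_self_lt_twinPos_iff {n : ℕ} (d : Bool) (q : Fin n) :
    q.castSucc < twinPos d q ↔ d = true := by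
  cases d <;> simp [twinPos]

/-- Insert a new minimum next to the minimum of `σ`. -/
def insertTwin {n : ℕ} (d : Bool) (σ : Perm (Fin (n + 1))) : Perm (Fin (n + 2)) :=
  insertPoint (twinPos d (σ.symm 0)) 0 σ

theorem insertTwin_injective {n : ℕ} (d : Bool) :
    Function.Injective (insertTwin d : Perm (Fin (n + 1)) → Perm (Fin (n + 2))) := by
  intro σ τ h
  unfold insertTwin at h
  have hpos : twinPos d (σ.symm 0) = twinPos d (τ.symm 0) :=
    eq_of_insertPoint_eq_zero (by rw [← h]; exact insertPoint_self _ _ _)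
  rw [hpos] at h
  exact insertPoint_injective _ _ h

theorem HasTwin.exists_eq_insertTwin {n : ℕ} {d : Bool} {τ : Perm (Fin (n + 2))}
    (h : HasTwin d τ) : ∃ σ, insertTwin d σ = τ := by
  obtain ⟨i, j, hi, hji, hd, hs⟩ := h
  obtain ⟨σ, rfl⟩ := exists_eq_insertPoint hi
  obtain ⟨q, rfl⟩ := Fin.exists_succAbove_eq hji
  have hq : σ.symm 0 = q := by
    have := hs.2 i (by simp) (i.succAbove q) (by simp) (i.succAbove (σ.symm 0))
      (by simp) (by
        rw [insertPoint_zero_succAbove, insertPoint_zero_succAbove, Fin.succ_le_succ_iff]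
        simp)
    simpa [Fin.succAbove_ne] using this
  refine ⟨σ, ?_⟩
  rw [insertTwin, hq]
  congr 1
  rw [Fin.succAbove_lt_iff_castSucc_lt] at hd
  cases d
  · have hle : i ≤ q.castSucc := not_lt.1 fun h => absurd (hd.1 h) (by simp)
    have hsa : i.succAbove q = q.succ := Fin.succAbove_of_le_castSucc _ _ hle
    rw [hsa] at hs
    have := hs.1 i (by simp) q.succ (by simp) q.castSucc hle Fin.castSucc_lt_succ.le
    simpa [Fin.castSucc_lt_succ.ne, twinPos] using this
  · have hlt : q.castSucc < i := hd.2 rfl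
    have hsa : i.succAbove q = q.castSucc := Fin.succAbove_of_castSucc_lt _ _ hlt
    rw [hsa] at hs
    have := hs.1 q.castSucc (by simp) i (by simp) q.succ Fin.castSucc_lt_succ.le
      (by rw [Fin.le_def]; rw [Fin.lt_def] at hlt; simp at hlt ⊢; omega)
    simpa [Fin.castSucc_lt_succ.ne', twinPos] using this

theorem hasTwin_insertTwin {n : ℕ} (d : Bool) (σ : Perm (Fin (n + 1))) :
    HasTwin d (insertTwin d σ) :=
  hasTwin_insertPoint (by simp) (fun _ h => castSucc_lt_twinPos_iff d h)
    (castSucc_self_lt_twinPos_iff d _)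

theorem almostSimple_insertTwin_iff {n : ℕ} {d : Bool} {σ : Perm (Fin (n + 3))} :
    AlmostSimple (insertTwin d σ) ↔ AlmostSimple σ ∧ ¬ HasTwin d σ :=
  ⟨fun h => h.of_insertPoint_twin (by simp) (fun _ h => castSucc_lt_twinPos_iff d h)
      (castSucc_self_lt_twinPos_iff d _),
    fun h => h.1.insertPoint_twin h.2 (by simp) (fun _ h => castSucc_lt_twinPos_iff d h)
      (castSucc_self_lt_twinPos_iff d _)⟩

theorem AlmostSimple.exists_hasTwin {n : ℕ} {σ : Perm (Fin (n + 3))} (hσ : AlmostSimple σ)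
    (s : Finset (Fin (n + 3))) (hs : IsPermInterval σ s) (hcard : 1 < s.card)
    (huniv : s ≠ Finset.univ) : ∃ d, HasTwin d σ := by
  induction hc : s.card using Nat.strong_induction_on generalizing s with
  | _ c ih =>
  obtain ⟨q, hq⟩ := σ.surjective 0
  have hqs : q ∈ s := by
    by_contra hqs
    exact (hσ.2.2 q hq s hs hqs).not_gt hcard
  have h0s : 0 ∉ s := fun h => huniv (hσ.eq_univ hq hs h hqs)
  have hpos : ∀ l ∈ s, 0 < l := fun l hl => Fin.pos_of_ne_zero (by rintro rfl; exact h0s hl)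
  have hval : ∀ l ∈ s, σ l < σ 0 := fun l hl => by
    by_contra! h
    exact h0s (hs.2 q hqs l hl 0 (by rw [hq]; exact Fin.zero_le _) h)
  obtain ⟨m, hms, hmax⟩ := s.exists_max_image σ ⟨q, hqs⟩
  rcases Nat.lt_or_eq_of_le hcard with hcard3 | hcard2
  · by_cases hmid : (∃ l ∈ s, l < m) ∧ ∃ u ∈ s, m < u
    · obtain ⟨⟨l, hl, hlm⟩, u, hu, hmu⟩ := hmid
      have hlt : ∀ l ∈ s, l < m → ∀ u ∈ s, m < u → σ l < σ u := by
        intro l hl hlm u hu hmu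
        by_contra! hul
        exact hσ.1.not_4231 (hpos l hl) hlm hmu
          (hul.lt_of_ne (σ.injective.ne (hlm.trans hmu).ne'))
          ((hmax l hl).lt_of_ne (σ.injective.ne hlm.ne)) (hval m hms)
      have hqm : q ∉ s.filter fun j => m ≤ j := by
        rw [Finset.mem_filter]
        rintro ⟨-, hmq⟩
        rcases hmq.eq_or_lt with rfl | hmq
        · exact (hmax l hl).not_gt (Perm.lt_of_apply_eq_zero hq hlm.ne)
        · have := hlt l hl hlm q hqs hmq
          rw [hq] at this
          exact Fin.not_lt_zero _ this
      have hI : IsPermInterval σ (s.filter fun j => m ≤ j) := by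
        constructor
        · intro a ha b hb k hak hkb
          rw [Finset.mem_filter] at *
          exact ⟨hs.1 a ha.1 b hb.1 k hak hkb, ha.2.trans hak⟩
        · intro a ha b hb k hak hkb
          rw [Finset.mem_filter] at *
          have hks := hs.2 a ha.1 b hb.1 k hak hkb
          refine ⟨hks, not_lt.1 fun hkm => ?_⟩
          rcases ha.2.eq_or_lt with rfl | hma
          · exact hkm.ne (σ.injective (le_antisymm (hmax k hks) hak))
          · exact (hlt k hks hkm a ha.1 hma).not_ge hak
      have := Finset.card_le_one.1 (hσ.2.2 q hq _ hI hqm) m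
        (Finset.mem_filter.2 ⟨hms, le_rfl⟩) u (Finset.mem_filter.2 ⟨hu, hmu.le⟩)
      exact (hmu.ne this).elim
    · have hI : IsPermInterval σ (s.erase m) := by
        constructor
        · intro a ha b hb k hak hkb
          rw [Finset.mem_erase] at *
          refine ⟨?_, hs.1 a ha.2 b hb.2 k hak hkb⟩
          rintro rfl
          exact hmid ⟨⟨a, ha.2, hak.lt_of_ne ha.1⟩, b, hb.2, hkb.lt_of_ne hb.1.symm⟩
        · intro a ha b hb k hak hkb
          rw [Finset.mem_erase] at *
          refine ⟨?_, hs.2 a ha.2 b hb.2 k hak hkb⟩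
          rintro rfl
          exact hb.1 (σ.injective (le_antisymm (hmax b hb.2) hkb))
      have hce := Finset.card_erase_of_mem hms
      refine ih _ (by omega) (s.erase m) hI (by omega) (fun h => ?_) rfl
      exact Finset.notMem_erase m s (h ▸ Finset.mem_univ m)
  · obtain ⟨x, y, hxy, rfl⟩ := Finset.card_eq_two.1 hcard2.symm
    rw [Finset.mem_insert, Finset.mem_singleton] at hqs
    rcases hqs with rfl | rfl
    · exact ⟨decide (y < q), q, y, hq, hxy.symm, by simp, hs⟩
    · exact ⟨decide (x < q), q, x, hq, hxy, by simp, Finset.pair_comm x q ▸ hs⟩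

theorem AlmostSimple.isSimple_or_hasTwin {n : ℕ} {σ : Perm (Fin (n + 3))}
    (hσ : AlmostSimple σ) : IsSimple σ ∨ HasTwin true σ ∨ HasTwin false σ := by
  by_contra! h
  obtain ⟨hS, ht, hf⟩ := h
  simp only [IsSimple, not_forall, not_or, not_le] at hS
  obtain ⟨s, hs, hcard, huniv⟩ := hS
  obtain ⟨d, hd⟩ := hσ.exists_hasTwin s hs hcard huniv
  cases d
  · exact hf hd
  · exact ht hd

theorem not_isPermInterval_pair {n : ℕ} {σ : Perm (Fin (n + 3))} (hS : IsSimple σ)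
    {i j : Fin (n + 3)} (hij : i ≠ j) : ¬ IsPermInterval σ {i, j} := by
  intro h
  have hc := Finset.card_pair hij
  rcases hS _ h with h | h
  · omega
  · rw [h, Finset.card_univ, Fintype.card_fin] at hc
    omega

theorem IsSimple.not_hasTwin {n : ℕ} {σ : Perm (Fin (n + 3))} (hS : IsSimple σ) (d : Bool) :
    ¬ HasTwin d σ := fun ⟨_, _, _, hjq, _, h⟩ => not_isPermInterval_pair hS hjq.symm h

theorem HasTwin.not_false {n : ℕ} {σ : Perm (Fin (n + 2))} (h : HasTwin true σ) :
    ¬ HasTwin false σ := by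
  rintro ⟨q', j', hq', hjq', hd', hs'⟩
  obtain ⟨q, j, hq, hjq, hd, hs⟩ := h
  obtain rfl : q' = q := σ.injective (hq'.trans hq.symm)
  have key : ∀ j, j ≠ q' → IsPermInterval σ {q', j} → σ j = 1 := by
    intro j hjq hs
    have h1 := hs.2 q' (by simp) j (by simp) (σ.symm 1) (by simp [hq])
      (by
        rw [Equiv.apply_symm_apply]
        exact Fin.one_le_of_ne_zero fun h => hjq (σ.injective (h.trans hq.symm)))
    rw [Finset.mem_insert, Finset.mem_singleton, Equiv.symm_apply_eq, Equiv.symm_apply_eq, hq] at h1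
    exact (h1.resolve_left (by simp)).symm
  obtain rfl : j = j' := σ.injective ((key j hjq hs).trans (key j' hjq' hs').symm)
  simp [hd] at hd'

theorem IsSimple.apply_one_ne_zero {n : ℕ} {σ : Perm (Fin (n + 3))} (hS : IsSimple σ)
    (h0 : σ 0 = 1) : σ 1 ≠ 0 := by
  intro h1
  refine not_isPermInterval_pair hS (i := 0) (j := 1) (by simp) ⟨?_, ?_⟩
  · intro a _ b hb k _ hkb
    have v1 : ((1 : Fin (n + 3)) : ℕ) = 1 := rfl
    have v0 : ((0 : Fin (n + 3)) : ℕ) = 0 := rfl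
    simp only [Finset.mem_insert, Finset.mem_singleton, Fin.ext_iff, Fin.le_def] at *
    omega
  · intro a _ b hb k _ hkb
    have v1 : ((1 : Fin (n + 3)) : ℕ) = 1 := rfl
    have v0 : ((0 : Fin (n + 3)) : ℕ) = 0 := rfl
    have hk : σ k = 0 ∨ σ k = 1 := by
      simp only [Finset.mem_insert, Finset.mem_singleton] at hb
      rcases hb with rfl | rfl <;> simp only [h0, h1, Fin.le_def] at hkb <;>
        rw [Fin.ext_iff, Fin.ext_iff] <;> omega
    rw [Finset.mem_insert, Finset.mem_singleton]
    exact hk.symm.imp (fun h => σ.injective (h.trans h0.symm))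
      fun h => σ.injective (h.trans h1.symm)

/-- Simple permutations in the class starting with their second smallest value. -/
def simpleFirst (n : ℕ) : Set (Perm (Fin (n + 3))) := {σ | (IsSimple σ ∧ InA σ) ∧ σ 0 = 1}

/-- Simple permutations in the class with their minimum in second position. -/
def simpleSecond (n : ℕ) : Set (Perm (Fin (n + 3))) := {σ | (IsSimple σ ∧ InA σ) ∧ σ 1 = 0}

/-- Almost simple permutations. -/
def almostSimples (n : ℕ) : Set (Perm (Fin (n + 3))) := {σ | AlmostSimple σ}

/-- Almost simple permutations with a twin of the minimum on the side `d`. -/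
def twins (d : Bool) (n : ℕ) : Set (Perm (Fin (n + 3))) := {σ | AlmostSimple σ ∧ HasTwin d σ}

theorem ncard_simpleSecond (n : ℕ) : (simpleSecond n).ncard = (simpleFirst n).ncard := by
  have : simpleSecond n = Equiv.symm '' simpleFirst n := by
    ext σ
    constructor
    · rintro ⟨⟨hS, hA⟩, h⟩
      exact ⟨σ.symm, ⟨⟨hS.symm, hA.symm⟩, (Equiv.symm_apply_eq _).2 h.symm⟩, Equiv.symm_symm σ⟩
    · rintro ⟨τ, ⟨⟨hS, hA⟩, h⟩, rfl⟩
      exact ⟨⟨hS.symm, hA.symm⟩, (Equiv.symm_apply_eq _).2 h.symm⟩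
  rw [this, Set.ncard_image_of_injective _ Equiv.symm_bijective.injective]

theorem disjoint_simpleFirst_simpleSecond (n : ℕ) : Disjoint (simpleFirst n) (simpleSecond n) :=
  Set.disjoint_left.2 fun _ h h' => h.1.1.apply_one_ne_zero h.2 h'.2

theorem setOf_isSimple_eq (n : ℕ) :
    {σ : Perm (Fin (n + 3)) | IsSimple σ ∧ InA σ} = simpleFirst n ∪ simpleSecond n := by
  ext σ
  constructor
  · intro h
    exact (h.1.corner h.2).imp (fun h' => ⟨h, h'⟩) fun h' => ⟨h, h'⟩
  · rintro (h | h)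
    · exact h.1
    · exact h.1

theorem simpleCount_eq (n : ℕ) : simpleCount (n + 3) = 2 * (simpleFirst n).ncard := by
  have : simpleCount (n + 3) = {σ : Perm (Fin (n + 3)) | IsSimple σ ∧ InA σ}.ncard := rfl
  rw [this, setOf_isSimple_eq, Set.ncard_union_eq (disjoint_simpleFirst_simpleSecond n),
    ncard_simpleSecond, two_mul]

theorem ncard_almostSimples (n : ℕ) : (almostSimples n).ncard =
    2 * (simpleFirst n).ncard + (twins true n).ncard + (twins false n).ncard := by
  have hunion : almostSimples n =
      (simpleFirst n ∪ simpleSecond n) ∪ (twins true n ∪ twins false n) := by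
    rw [← setOf_isSimple_eq]
    ext σ
    constructor
    · intro h
      rcases h.isSimple_or_hasTwin with hS | ht | hf
      · exact Or.inl ⟨hS, h.1⟩
      · exact Or.inr (Or.inl ⟨h, ht⟩)
      · exact Or.inr (Or.inr ⟨h, hf⟩)
    · rintro (h | h | h)
      · exact h.1.almostSimple h.2
      · exact h.1
      · exact h.1
  have hdisj : Disjoint (simpleFirst n ∪ simpleSecond n) (twins true n ∪ twins false n) := by
    rw [← setOf_isSimple_eq, Set.disjoint_left]
    rintro σ h (h' | h')
    · exact h.1.not_hasTwin _ h'.2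
    · exact h.1.not_hasTwin _ h'.2
  have hdisj' : Disjoint (twins true n) (twins false n) :=
    Set.disjoint_left.2 fun _ h h' => h.2.not_false h'.2
  rw [hunion, Set.ncard_union_eq hdisj, Set.ncard_union_eq hdisj',
    Set.ncard_union_eq (disjoint_simpleFirst_simpleSecond n), ncard_simpleSecond]
  ring

theorem ncard_simpleFirst_succ (n : ℕ) :
    (simpleFirst (n + 1)).ncard + (simpleFirst n).ncard = (almostSimples n).ncard := by
  have himage : simpleFirst (n + 1) = insertPoint 0 1 '' (almostSimples n \ simpleFirst n) := by
    ext τ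
    constructor
    · rintro ⟨⟨hS, hA⟩, h⟩
      obtain ⟨σ, rfl⟩ := exists_eq_insertPoint h
      obtain ⟨h1, h2⟩ := hS.almostSimple_of_insertPoint hA
      exact ⟨σ, ⟨h1, fun h => h2 h.2⟩, rfl⟩
    · rintro ⟨σ, ⟨h1, h2⟩, rfl⟩
      have h2' : σ 0 ≠ 1 := fun h => h2 ⟨⟨h1.isSimple h, h1.1⟩, h⟩
      exact ⟨⟨h1.isSimple_insertPoint h2', h1.1.insertPoint_zero_one⟩, insertPoint_self _ _ _⟩
  rw [himage, Set.ncard_image_of_injective _ (insertPoint_injective _ _)]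
  exact Set.ncard_sdiff_add_ncard_of_subset fun σ h => h.1.1.almostSimple h.1.2

theorem ncard_twins_succ (d : Bool) (n : ℕ) :
    (twins d (n + 1)).ncard + (twins d n).ncard = (almostSimples n).ncard := by
  have himage : twins d (n + 1) = insertTwin d '' (almostSimples n \ twins d n) := by
    ext τ
    constructor
    · rintro ⟨hτ, h⟩
      obtain ⟨σ, rfl⟩ := h.exists_eq_insertTwin
      obtain ⟨h1, h2⟩ := almostSimple_insertTwin_iff.1 hτ
      exact ⟨σ, ⟨h1, fun h => h2 h.2⟩, rfl⟩
    · rintro ⟨σ, ⟨h1, h2⟩, rfl⟩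
      exact ⟨almostSimple_insertTwin_iff.2 ⟨h1, fun h => h2 ⟨h1, h⟩⟩, hasTwin_insertTwin d σ⟩
  rw [himage, Set.ncard_image_of_injective _ (insertTwin_injective d)]
  exact Set.ncard_sdiff_add_ncard_of_subset fun σ h => h.1

theorem not_contains_of_lt {k n : ℕ} (p : Perm (Fin k)) (σ : Perm (Fin n)) (h : n < k) :
    ¬ Contains p σ := by
  rintro ⟨f, hf, -⟩
  have := Fintype.card_le_of_injective f hf.injective
  simp only [Fintype.card_fin] at this
  omega

theorem inA_of_length_three (σ : Perm (Fin 3)) : InA σ :=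
  ⟨not_contains_of_lt _ _ (by simp), not_contains_of_lt _ _ (by simp),
    not_contains_of_lt _ _ (by simp), not_contains_of_lt _ _ (by simp)⟩

instance {n : ℕ} (σ : Perm (Fin n)) (s : Finset (Fin n)) : Decidable (IsPermInterval σ s) :=
  decidable_of_iff ((∀ a b j : Fin n, a ∈ s ∧ b ∈ s ∧ a ≤ j ∧ j ≤ b → j ∈ s) ∧
    ∀ a b j : Fin n, a ∈ s ∧ b ∈ s ∧ σ a ≤ σ j ∧ σ j ≤ σ b → j ∈ s) (by
      unfold IsPermInterval
      grind)

theorem simpleFirst_zero : simpleFirst 0 = ∅ := by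
  rw [Set.eq_empty_iff_forall_notMem]
  rintro σ ⟨⟨hS, -⟩, h⟩
  revert σ
  unfold IsSimple
  decide +kernel

theorem almostSimples_zero : almostSimples 0 = {(finRotate 3).symm} := by
  ext σ
  simp only [almostSimples, AlmostSimple, inA_of_length_three, true_and, Set.mem_ofPred_eq,
    Set.mem_singleton_iff]
  revert σ
  decide +kernel

theorem ncard_recurrence (n : ℕ) : (almostSimples n).ncard = 3 ^ n ∧
    ((simpleFirst (n + 1)).ncard : ℤ) = 3 * (simpleFirst n).ncard + (-1) ^ n := by
  induction n with
  | zero =>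
    have h1 : (almostSimples 0).ncard = 1 := by rw [almostSimples_zero, Set.ncard_singleton]
    have h2 : (simpleFirst 0).ncard = 0 := by rw [simpleFirst_zero, Set.ncard_empty]
    have h3 := ncard_simpleFirst_succ 0
    refine ⟨h1, ?_⟩
    rw [h2] at *
    simp_all
  | succ n ih =>
    have h1 := ncard_almostSimples n
    have h2 := ncard_almostSimples (n + 1)
    have h3 := ncard_simpleFirst_succ n
    have h4 := ncard_simpleFirst_succ (n + 1)
    have h5 := ncard_twins_succ true n
    have h6 := ncard_twins_succ false n
    have h7 : (almostSimples (n + 1)).ncard = 3 * (almostSimples n).ncard := by omega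
    refine ⟨by rw [h7, ih.1, pow_succ, mul_comm], ?_⟩
    have := ih.2
    rw [pow_succ]
    zify at h3 h4 h7
    linarith

theorem statement_15 :
    simpleCount 4 = 2 ∧
    (∀ n : ℕ, 4 ≤ n →
      (simpleCount (n + 1) : ℤ) = 3 * simpleCount n + 2 * (-1) ^ (n + 1)) := by
  constructor
  · have h : (simpleFirst 1).ncard = 1 := by
      simpa [simpleFirst_zero] using (ncard_recurrence 0).2
    rw [simpleCount_eq 1, h]
  · intro n hn
    obtain ⟨m, rfl⟩ : ∃ m, n = m + 3 := ⟨n - 3, by omega⟩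
    have h := (ncard_recurrence m).2
    rw [show m + 3 + 1 = (m + 1) + 3 by ring, simpleCount_eq, simpleCount_eq]
    push_cast
    rw [h]
    ring
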